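/- arXiv:2509.17758 — 2 statements merged into one kernel-verified Lean document; each statement's English description precedes it below -/
import Mathlib

section
/- Let d = 2^n with n ≥ 1, let δ be a nonzero element of ZMod (2^n), and let T ⊆ ZMod (2^n) be a set of representatives such that T and T + δ are disjoint with union all of ZMod (2^n). Then Σ_{i ∈ T} Σ_{w ∈ ZMod 2} M^{i, i+δ}_w equals the identity matrix on ℂ^(ZMod (2^n)); that is, the RR-QKD measurement operators indexed by the matching pairs and the bit w form a complete POVM. -/
open Matrix

/-- The (unnormalized) vector `e_i + (-1)^w e_j`. -/
noncomputable def rrVec {ι : Type*} [DecidableEq ι] (i j : ι) (w : ZMod 2) : ι → ℂ :=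
  fun t => (if t = i then 1 else 0) + (-1 : ℂ) ^ w.val * (if t = j then 1 else 0)

/-- The RR-QKD POVM element `M^{i,j}_w = (1/2)(e_i + (-1)^w e_j)(e_i + (-1)^w e_j)^*`. -/
noncomputable def rrPOVM {ι : Type*} [DecidableEq ι] (i j : ι) (w : ZMod 2) :
    Matrix ι ι ℂ :=
  (1 / 2 : ℂ) • Matrix.vecMulVec (rrVec i j w) (star (rrVec i j w))

lemma rrPOVM_sum {ι : Type*} [DecidableEq ι] (i j a b : ι) :
    (∑ w : ZMod 2, rrPOVM i j w) a b =
      (if a = i then (if b = i then (1 : ℂ) else 0) else 0) +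
      (if a = j then (if b = j then (1 : ℂ) else 0) else 0) := by
  have h : (∑ w : ZMod 2, rrPOVM i j w) = rrPOVM i j 0 + rrPOVM i j 1 :=
    Fin.sum_univ_two (fun w : ZMod 2 => rrPOVM i j w)
  have h1 : (1 : ZMod 2).val = 1 := rfl
  rw [h]
  simp only [rrPOVM, rrVec, Matrix.add_apply, Matrix.smul_apply, Matrix.vecMulVec_apply,
    Pi.star_apply, ZMod.val_zero, h1, pow_zero, pow_one, smul_eq_mul]
  split_ifs <;> simp <;> norm_num

/-- For `d = 2^n`, `n ≥ 1`, a nonzero shift `δ` and a matching `T` for `δ`, the RR-QKD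
measurement operators indexed by the matched pairs and the bit `w` sum to the identity,
i.e. they form a complete POVM. -/
theorem rr_povm_complete (n : ℕ) (hn : 1 ≤ n) (δ : ZMod (2 ^ n)) (hδ : δ ≠ 0)
    (T : Finset (ZMod (2 ^ n)))
    (hdisj : Disjoint T (T.image (· + δ)))
    (hunion : T ∪ T.image (· + δ) = Finset.univ) :
    ∑ i ∈ T, ∑ w : ZMod 2, rrPOVM i (i + δ) w = (1 : Matrix (ZMod (2 ^ n)) (ZMod (2 ^ n)) ℂ) := by
  have : NeZero (2 ^ n) := ⟨by positivity⟩
  ext a b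
  rw [Matrix.sum_apply]
  simp only [rrPOVM_sum]
  rw [Finset.sum_add_distrib]
  have h2 : ∑ i ∈ T, (if a = i + δ then (if b = i + δ then (1 : ℂ) else 0) else 0) =
      ∑ j ∈ T.image (· + δ), (if a = j then (if b = j then (1 : ℂ) else 0) else 0) := by
    rw [Finset.sum_image (fun x _ y _ h => add_right_cancel h)]
  rw [h2, ← Finset.sum_union hdisj, hunion, Finset.sum_ite_eq]
  simp [Matrix.one_apply, eq_comm]
end

section
/- Let d = 2^n with n ≥ 1, let δ be a nonzero element of ZMod (2^n), let T ⊆ ZMod (2^n) satisfy T ∩ (T + δ) = ∅ and T ∪ (T + δ) = ZMod (2^n), and let s : ZMod (2^n) → ZMod 2 with ψ_s = (1/√d) Σ_t (−1)^{s t} e_t. Then Σ_{i ∈ T} ⟪ψ_s, M^{i, i+δ}_{s i + s(i+δ)} ψ_s⟫ = 1; that is, in the noiseless case the Round-Robin measurement yields, with probability one, some pair (i, j) of the matching together with the correct bit w = s i ⊕ s j. -/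
open Matrix

theorem rr_sign_add (a b : ZMod 2) :
    (-1 : ℂ) ^ (a + b).val = (-1) ^ a.val * (-1) ^ b.val := by
  rw [ZMod.val_add, ← neg_one_pow_eq_pow_mod_two, pow_add]

theorem rr_sign_sq (a : ZMod 2) : (-1 : ℂ) ^ a.val * (-1) ^ a.val = 1 := by
  rw [← mul_pow]; simp

theorem rr_term {ι : Type*} [Fintype ι] [DecidableEq ι] (c : ℝ) (s : ι → ZMod 2) (i j : ι) :
    star (fun t => ((c : ℂ))⁻¹ * (-1 : ℂ) ^ (s t).val) ⬝ᵥ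
      (rrPOVM i j (s i + s j)).mulVec (fun t => ((c : ℂ))⁻¹ * (-1 : ℂ) ^ (s t).val)
      = 2 * ((c : ℂ)⁻¹ * (c : ℂ)⁻¹) := by
  have h1 : star (rrVec i j (s i + s j)) ⬝ᵥ (fun t => ((c : ℂ))⁻¹ * (-1 : ℂ) ^ (s t).val)
      = 2 * ((c : ℂ)⁻¹ * (-1) ^ (s i).val) := by
    simp only [dotProduct, rrVec, Pi.star_apply, star_add, star_mul', star_pow, star_neg,
      star_one, apply_ite star, star_zero, add_mul, Finset.sum_add_distrib, rr_sign_add]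
    simp
    linear_combination ((c : ℂ)⁻¹ * (-1) ^ (s i).val) * rr_sign_sq (s j)
  have h2 : star (fun t => ((c : ℂ))⁻¹ * (-1 : ℂ) ^ (s t).val) ⬝ᵥ rrVec i j (s i + s j)
      = 2 * ((c : ℂ)⁻¹ * (-1) ^ (s i).val) := by
    simp only [dotProduct, rrVec, Pi.star_apply, star_mul', star_pow, star_neg,
      star_one, mul_add, Finset.sum_add_distrib, rr_sign_add]
    simp
    linear_combination ((c : ℂ)⁻¹ * (-1) ^ (s i).val) * rr_sign_sq (s j)
  rw [rrPOVM, Matrix.smul_mulVec, Matrix.vecMulVec_mulVec, h1, dotProduct_smul,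
    dotProduct_smul, h2]
  simp only [smul_eq_mul, MulOpposite.smul_eq_mul_unop, MulOpposite.unop_op]
  linear_combination (2 * (c : ℂ)⁻¹ * (c : ℂ)⁻¹) * rr_sign_sq (s i)

/-- In the noiseless case, the Round-Robin measurement on `ψ_s` produces, with total
probability one, some pair `(i, i+δ)` of the matching together with the correct bit
`w = s i ⊕ s (i+δ)`. -/
theorem rr_noiseless_correct (n : ℕ) (hn : 1 ≤ n) (δ : ZMod (2 ^ n)) (hδ : δ ≠ 0)
    (T : Finset (ZMod (2 ^ n)))
    (hdisj : Disjoint T (T.image (· + δ)))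
    (hunion : T ∪ T.image (· + δ) = Finset.univ)
    (s : ZMod (2 ^ n) → ZMod 2) :
    let ψ : ZMod (2 ^ n) → ℂ :=
      fun t => ((Real.sqrt (2 ^ n) : ℂ))⁻¹ * (-1 : ℂ) ^ (s t).val
    ∑ i ∈ T, star ψ ⬝ᵥ (rrPOVM i (i + δ) (s i + s (i + δ))).mulVec ψ = 1 := by
  intro ψ
  have hcard : T.card + T.card = 2 ^ n := by
    have h := Finset.card_union_of_disjoint hdisj
    rw [hunion, Finset.card_univ, ZMod.card,
      Finset.card_image_of_injective _ (add_left_injective δ)] at h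
    exact h.symm
  have hc : (T.card : ℂ) + T.card = 2 ^ n := by exact_mod_cast hcard
  have hs : ((Real.sqrt (2 ^ n) : ℝ) : ℂ) * (Real.sqrt (2 ^ n) : ℝ) = 2 ^ n := by
    rw [← Complex.ofReal_mul, Real.mul_self_sqrt (by positivity)]; push_cast; rfl
  have hne : (2 : ℂ) ^ n ≠ 0 := pow_ne_zero _ two_ne_zero
  rw [Finset.sum_congr rfl (fun i _ => rr_term (Real.sqrt (2 ^ n)) s i (i + δ)),
    Finset.sum_const, nsmul_eq_mul, ← mul_inv, hs]
  field_simp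
  linear_combination hc
end
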